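/- Let c ∈ (1, 2) be non-integer and p(t) = t^c. For j ≥ 1, define μ_j = ∑_{2^{j−1} < n ≤ 2^j} (e^{2πi p(n)}/n) δ_n on ℤ. Then there exists ε = ε(c) > 0 such that for all x ≠ 0, |μ_j * μ̃_j(x)| ≤ C 2^{−(1+ε)j}, where μ̃(y) = conj(μ(−y)). -/

import Mathlib

open Finset

/-- The measure `μ_j = ∑_{2^{j-1} < n ≤ 2^j} (e(n^c)/n) δ_n` on `ℤ`, as a function. -/
noncomputable def fracMu (c : ℝ) (j : ℕ) : ℤ → ℂ :=
  fun n => if 2 ^ (j - 1) < n ∧ n ≤ 2 ^ j then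
    Complex.exp (2 * Real.pi * Complex.I * (((n : ℝ) ^ c : ℝ))) / (n : ℂ) else 0

/-- Convolution on `ℤ`. -/
noncomputable def zconv (g h : ℤ → ℂ) : ℤ → ℂ :=
  fun x => ∑' n : ℤ, g n * h (x - n)

/-- Reflection and conjugation: `μ̃(x) = conj (μ (-x))`. -/
noncomputable def zrefl (g : ℤ → ℂ) : ℤ → ℂ :=
  fun x => starRingEnd ℂ (g (-x))


noncomputable def eE (t : ℝ) : ℂ := Complex.exp (2 * Real.pi * Complex.I * (t : ℂ))

lemma eE_add (s t : ℝ) : eE (s + t) = eE s * eE t := by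
  unfold eE; rw [← Complex.exp_add]; congr 1; push_cast; ring

lemma eE_int (k : ℤ) : eE k = 1 := by
  unfold eE; rw [Complex.exp_eq_one_iff]; exact ⟨k, by push_cast; ring⟩

lemma eE_norm (t : ℝ) : ‖eE t‖ = 1 := by
  unfold eE
  have : 2 * Real.pi * Complex.I * (t : ℂ) = ((2 * Real.pi * t : ℝ) : ℂ) * Complex.I := by
    push_cast; ring
  rw [this, Complex.norm_exp_ofReal_mul_I]

noncomputable def qq (t : ℝ) : ℝ := Real.cos (Real.pi * t) / Real.sin (Real.pi * t)

noncomputable def uU (t : ℝ) : ℂ := -1/2 - Complex.I / 2 * (qq t : ℂ)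

lemma sin_pos_aux {t : ℝ} (h0 : 0 < t) (h1 : t < 1) : 0 < Real.sin (Real.pi * t) := by
  apply Real.sin_pos_of_pos_of_lt_pi
  · positivity
  · nlinarith [Real.pi_pos]

lemma uU_eq {t : ℝ} (h0 : 0 < t) (h1 : t < 1) : (eE t - 1) * uU t = 1 := by
  have hs := sin_pos_aux h0 h1
  have hs' : (Real.sin (Real.pi * t) : ℂ) ≠ 0 := by exact_mod_cast hs.ne'
  have hE : eE t = ((Real.cos (Real.pi * t) : ℂ) + Real.sin (Real.pi * t) * Complex.I) ^ 2 := by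
    have : eE t = eE (t/2) ^ 2 := by rw [sq, ← eE_add]; congr 1; ring
    rw [this]
    unfold eE
    congr 1
    have : 2 * Real.pi * Complex.I * ((t / 2 : ℝ) : ℂ) = ((Real.pi * t : ℝ) : ℂ) * Complex.I := by
      push_cast; ring
    rw [this, Complex.exp_mul_I]
    push_cast; rfl
  have hcs : (Real.cos (Real.pi * t) : ℂ)^2 + (Real.sin (Real.pi * t) : ℂ)^2 = 1 := by
    have := Real.cos_sq_add_sin_sq (Real.pi * t)
    exact_mod_cast this
  rw [hE]
  unfold uU qq
  rw [Complex.ofReal_div]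
  generalize (Real.cos (Real.pi * t) : ℂ) = x at *
  generalize (Real.sin (Real.pi * t) : ℂ) = y at *
  have hI := Complex.I_sq
  have h1 : (x + y * Complex.I)^2 - 1 = 2 * y * Complex.I * (x + y * Complex.I) := by
    linear_combination (-y^2) * hI + hcs
  have h2 : -1/2 - Complex.I / 2 * (x / y) = - Complex.I / 2 * (x - y * Complex.I) / y := by
    field_simp
    linear_combination (-y) * hI
  rw [h1, h2]
  field_simp
  linear_combination (-x^2 + y^2 * Complex.I^2) * hI + hcs - y^2 * hI

lemma qq_anti {s t : ℝ} (h0 : 0 < s) (hst : s ≤ t) (h1 : t < 1) : qq t ≤ qq s := by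
  have a := sin_pos_aux h0 (by linarith)
  have b := sin_pos_aux (by linarith) h1
  unfold qq
  rw [div_le_div_iff₀ b a]
  have : 0 ≤ Real.sin (Real.pi * t - Real.pi * s) := by
    apply Real.sin_nonneg_of_nonneg_of_le_pi <;> nlinarith [Real.pi_pos]
  rw [Real.sin_sub] at this
  linarith

lemma qq_bound {t δ : ℝ} (hδ : 0 < δ) (h0 : δ ≤ t) (h1 : t ≤ 1 - δ) : |qq t| ≤ 1 / (2 * δ) := by
  have a := sin_pos_aux (t := t) (by linarith) (by linarith)
  have key : 2 * δ ≤ Real.sin (Real.pi * t) := by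
    rcases le_total t (1/2) with h | h
    · have := Real.mul_le_sin (x := Real.pi * t) (by have := Real.pi_pos; nlinarith) (by nlinarith [Real.pi_pos])
      have e : 2 / Real.pi * (Real.pi * t) = 2 * t := by field_simp
      linarith
    · have := Real.mul_le_sin (x := Real.pi * (1 - t)) (by have := Real.pi_pos; nlinarith) (by nlinarith [Real.pi_pos])
      have e : 2 / Real.pi * (Real.pi * (1 - t)) = 2 * (1 - t) := by field_simp
      have e2 : Real.sin (Real.pi * (1 - t)) = Real.sin (Real.pi * t) := by
        rw [← Real.sin_pi_sub]; congr 1; ring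
      linarith
  unfold qq
  rw [abs_div, abs_of_pos a]
  exact div_le_div₀ (by norm_num) (Real.abs_cos_le_one _) (by linarith) key

lemma uU_bound {t δ : ℝ} (hδ : 0 < δ) (h0 : δ ≤ t) (h1 : t ≤ 1 - δ) : ‖uU t‖ ≤ 1 / (2 * δ) := by
  have := qq_bound hδ h0 h1
  have h : ‖uU t‖ ≤ 1/2 + |qq t| / 2 := by
    unfold uU
    refine (norm_sub_le _ _).trans ?_
    rw [norm_mul, Complex.norm_real]
    simp
    linarith
  have h2 : 1 ≤ 1 / (2 * δ) := by rw [le_div_iff₀ (by linarith)]; linarith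
  linarith

lemma uU_diff (s t : ℝ) (h : qq t ≤ qq s) : ‖uU s - uU t‖ = (qq s - qq t) / 2 := by
  have : uU s - uU t = - (Complex.I / 2) * ((qq s - qq t : ℝ) : ℂ) := by
    unfold uU; push_cast; ring
  rw [this, norm_mul, Complex.norm_real, Real.norm_eq_abs, abs_of_nonneg (by linarith)]
  simp; ring

lemma KL (f d : ℕ → ℝ) (k : ℤ) (δ : ℝ) (hδ : 0 < δ) (a b : ℕ)
    (hf : ∀ i, f (i+1) = f i + d i)
    (hd : ∀ i, a ≤ i → i < b → k + δ ≤ d i ∧ d i ≤ k + 1 - δ)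
    (hm : ∀ i, a ≤ i → i + 1 < b → d i ≤ d (i+1)) :
    ‖∑ i ∈ Ico a b, eE (f i)‖ ≤ 2 / δ := by
  rcases le_or_gt b a with hab | hab
  · rw [Ico_eq_empty (by omega)]; simp; positivity
  have hstep : ∀ i, a ≤ i → i < b → eE (f i) = (eE (f (i+1)) - eE (f i)) * uU (d i - k) := by
    intro i h1 h2
    obtain ⟨h3, h4⟩ := hd i h1 h2
    have := uU_eq (t := d i - k) (by linarith) (by linarith)
    have e : eE (f (i+1)) = eE (f i) * eE (d i - k) := by
      rw [hf, show f i + d i = f i + ((d i - k) + (k : ℤ)) by ring, eE_add, eE_add, eE_int, mul_one]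
    rw [e]
    linear_combination (- eE (f i)) * this
  have main : ∀ m, a ≤ m → m < b → ∃ R : ℂ,
      ∑ i ∈ Ico a (m+1), eE (f i) = eE (f (m+1)) * uU (d m - k) + R ∧
      ‖R‖ ≤ ‖uU (d a - k)‖ + (qq (d a - k) - qq (d m - k)) / 2 := by
    intro m ham
    induction m, ham using Nat.le_induction with
    | base =>
      intro h
      refine ⟨- eE (f a) * uU (d a - k), ?_, ?_⟩
      · simp
        have := hstep a le_rfl h
        linear_combination this
      · rw [norm_mul, norm_neg, eE_norm]; simp
    | succ m ham ih =>
      intro h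
      obtain ⟨R, h1, h2⟩ := ih (by omega)
      refine ⟨R + eE (f (m+1)) * (uU (d m - k) - uU (d (m+1) - k)), ?_, ?_⟩
      · rw [sum_Ico_succ_top (by omega), h1]
        have := hstep (m+1) (by omega) h
        linear_combination this
      · refine (norm_add_le _ _).trans ?_
        obtain ⟨h3, h4⟩ := hd m ham (by omega)
        obtain ⟨h5, h6⟩ := hd (m+1) (by omega) h
        have h7 := hm m ham h
        rw [norm_mul, eE_norm, uU_diff _ _ (qq_anti (by linarith) (by linarith) (by linarith))]
        linarith
  obtain ⟨R, h1, h2⟩ := main (b-1) (by omega) (by omega)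
  rw [show b - 1 + 1 = b by omega] at h1
  rw [h1]
  refine (norm_add_le _ _).trans ?_
  rw [norm_mul, eE_norm]
  obtain ⟨h3, h4⟩ := hd a le_rfl hab
  obtain ⟨h5, h6⟩ := hd (b-1) (by omega) (by omega)
  have b1 := uU_bound hδ (t := d a - k) (by linarith) (by linarith)
  have b2 := uU_bound hδ (t := d (b-1) - k) (by linarith) (by linarith)
  have b3 := abs_le.1 (qq_bound hδ (t := d a - k) (by linarith) (by linarith))
  have b4 := abs_le.1 (qq_bound hδ (t := d (b-1) - k) (by linarith) (by linarith))
  have e : 2 / δ = 4 * (1 / (2 * δ)) := by field_simp; norm_num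
  have : 0 < 1 / (2 * δ) := by positivity
  rw [e]; linarith

lemma ordc (S : Finset ℕ) (h : ∀ a b c, a ∈ S → c ∈ S → a ≤ b → b ≤ c → b ∈ S) :
    ∃ a b, S = Ico a b := by
  rcases S.eq_empty_or_nonempty with rfl | hne
  · exact ⟨0, 0, by simp⟩
  · refine ⟨S.min' hne, S.max' hne + 1, ?_⟩
    ext x
    rw [mem_Ico]
    constructor
    · intro hx; exact ⟨S.min'_le x hx, Nat.lt_succ_of_le (S.le_max' x hx)⟩
    · rintro ⟨h1, h2⟩
      exact h _ _ _ (S.min'_mem hne) (S.max'_mem hne) h1 (by omega)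

lemma sep (d : ℕ → ℝ) (l : ℝ) (M : ℕ) (hl : ∀ i, i < M → d i + l ≤ d (i+1)) (m n : ℕ) (hmn : m ≤ n)
    (hn : n ≤ M) : d m + (n - m : ℝ) * l ≤ d n := by
  induction n, hmn using Nat.le_induction with
  | base => simp
  | succ n hmn ih =>
    have := ih (by omega)
    have h2 := hl n (by omega)
    push_cast; linarith

lemma card_bd (d : ℕ → ℝ) (l δ p : ℝ) (M : ℕ) (h0 : 0 < l) (hδ : 0 < δ)
    (hl : ∀ i, i < M → d i + l ≤ d (i+1)) (S : Finset ℕ) (hS : ∀ i ∈ S, i < M)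
    (hp : ∀ i ∈ S, p ≤ d i ∧ d i ≤ p + δ)
    (h : ∀ a b c, a ∈ S → c ∈ S → a ≤ b → b ≤ c → b ∈ S) : (S.card : ℝ) ≤ δ / l + 1 := by
  obtain ⟨a, b, rfl⟩ := ordc S h
  rcases le_or_gt b a with hab | hab
  · rw [Ico_eq_empty (by omega)]; simp; positivity
  have ha : a ∈ Ico a b := by simp; omega
  have hb : b - 1 ∈ Ico a b := by simp; omega
  have := sep d l M hl a (b-1) (by omega) (hS _ hb).le
  have h1 := hp _ ha
  have h2 := hp _ hb
  rw [Nat.card_Ico, Nat.cast_sub hab.le]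
  have e : ((b - 1 : ℕ) : ℝ) = b - 1 := by rw [Nat.cast_sub (by omega)]; simp
  rw [e] at this
  have : ((b:ℝ) - 1 - a) ≤ δ / l := by rw [le_div_iff₀ h0]; linarith
  linarith

lemma norm_sum_card (f : ℕ → ℝ) (S : Finset ℕ) : ‖∑ i ∈ S, eE (f i)‖ ≤ S.card := by
  refine (norm_sum_le _ _).trans ?_
  simp [eE_norm]

lemma block (f d : ℕ → ℝ) (k : ℤ) (δ l : ℝ) (hδ : 0 < δ) (h0 : 0 < l) (M : ℕ)
    (hf : ∀ i, f (i+1) = f i + d i)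
    (hl : ∀ i, i < M → d i + l ≤ d (i+1)) :
    ‖∑ i ∈ (range M) with ⌊d i⌋ = k, eE (f i)‖ ≤ 2 / δ + 2 * (δ / l + 1) := by
  have mono : ∀ m n, m ≤ n → n < M → d m ≤ d n := by
    intro m n h1 h2
    have := sep d l M hl m n h1 h2.le
    have h3 : (m:ℝ) ≤ n := by exact_mod_cast h1
    nlinarith
  have hfl : ∀ i, ⌊d i⌋ = k ↔ (k : ℝ) ≤ d i ∧ d i < k + 1 := fun i => Int.floor_eq_iff
  set F := (range M).filter (fun i => ⌊d i⌋ = k) with hF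
  rw [← sum_filter_add_sum_filter_not F (fun i => d i < k + δ),
    ← sum_filter_add_sum_filter_not (F.filter (fun i => ¬ d i < k + δ)) (fun i => k + 1 - δ < d i)]
  have A := card_bd d l δ k M h0 hδ hl (F.filter (fun i => d i < k + δ))
    (by intro i hi; simp [hF] at hi; exact hi.1.1)
    (by intro i hi; simp only [hF, mem_filter, hfl] at hi; constructor <;> linarith [hi.1.2.1, hi.2])
    (by
      intro a b c ha hc hab hbc
      simp only [hF, mem_filter, hfl, mem_range] at ha hc ⊢
      have := mono a b hab (by omega)
      have := mono b c hbc (by omega)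
      refine ⟨⟨by omega, by linarith, by linarith⟩, by linarith⟩)
  have B := card_bd d l δ (k+1-δ) M h0 hδ hl
    ((F.filter (fun i => ¬ d i < k + δ)).filter (fun i => k + 1 - δ < d i))
    (by intro i hi; simp [hF] at hi; exact hi.1.1.1)
    (by intro i hi; simp only [hF, mem_filter, hfl] at hi; constructor <;> linarith [hi.1.1.2.2, hi.2])
    (by
      intro a b c ha hc hab hbc
      simp only [hF, mem_filter, hfl, mem_range, not_lt] at ha hc ⊢
      have := mono a b hab (by omega)
      have := mono b c hbc (by omega)
      refine ⟨⟨⟨by omega, by linarith, by linarith⟩, by linarith⟩, by linarith⟩)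
  have Cc : ‖∑ i ∈ ((F.filter (fun i => ¬ d i < k + δ)).filter (fun i => ¬ k + 1 - δ < d i)), eE (f i)‖
      ≤ 2 / δ := by
    obtain ⟨a, b, hab⟩ := ordc ((F.filter (fun i => ¬ d i < k + δ)).filter (fun i => ¬ k + 1 - δ < d i))
      (by
      intro a b c ha hc hab hbc
      simp only [hF, mem_filter, hfl, mem_range, not_lt] at ha hc ⊢
      have := mono a b hab (by omega)
      have := mono b c hbc (by omega)
      refine ⟨⟨⟨by omega, by linarith, by linarith⟩, by linarith⟩, by linarith⟩)
    rw [hab]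
    have hmem : ∀ i, a ≤ i → i < b → i < M ∧ k + δ ≤ d i ∧ d i ≤ k + 1 - δ := by
      intro i h1 h2
      have : i ∈ Ico a b := by simp; omega
      rw [← hab] at this
      simp only [hF, mem_filter, hfl, mem_range, not_lt] at this
      exact ⟨this.1.1.1, this.1.2, this.2⟩
    apply KL f d k δ hδ a b hf (fun i h1 h2 => (hmem i h1 h2).2)
    intro i h1 h2
    exact mono _ _ (by omega) (hmem (i+1) (by omega) h2).1
  have A' := (norm_sum_card f _).trans A
  have B' := (norm_sum_card f _).trans B
  refine (norm_add_le _ _).trans ?_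
  have := norm_add_le (∑ i ∈ ((F.filter (fun i => ¬ d i < k + δ)).filter (fun i => k + 1 - δ < d i)), eE (f i))
    (∑ i ∈ ((F.filter (fun i => ¬ d i < k + δ)).filter (fun i => ¬ k + 1 - δ < d i)), eE (f i))
  linarith

/-- second derivative test, `d` takes values in `[-D, 0]`. -/
lemma vdc (f d : ℕ → ℝ) (l D : ℝ) (h0 : 0 < l) (hl4 : l ≤ 1) (hD : 0 ≤ D) (M : ℕ)
    (hf : ∀ i, f (i+1) = f i + d i)
    (hl : ∀ i, i < M → d i + l ≤ d (i+1))
    (hd : ∀ i, i < M → -D ≤ d i ∧ d i ≤ 0) :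
    ‖∑ i ∈ range M, eE (f i)‖ ≤ (D + 2) * (6 / √l) := by
  have hs : 0 < √l := Real.sqrt_pos.2 h0
  have hs1 : √l ≤ 1 := by rw [Real.sqrt_le_iff]; constructor <;> linarith
  have hmaps : ∀ i ∈ range M, ⌊d i⌋ ∈ Icc ⌊-D⌋ 0 := by
    intro i hi
    obtain ⟨h1, h2⟩ := hd i (by simpa using hi)
    rw [mem_Icc]
    refine ⟨Int.floor_le_floor h1, ?_⟩
    have := Int.floor_le_floor h2
    simpa using this
  rw [← sum_fiberwise_of_maps_to hmaps]
  refine (norm_sum_le _ _).trans ?_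
  refine (sum_le_sum (fun k _ => block f d k (√l) l hs h0 M hf hl)).trans ?_
  rw [sum_const, nsmul_eq_mul]
  have hc : ((Icc ⌊-D⌋ 0).card : ℝ) ≤ D + 2 := by
    have h1 : ⌊-D⌋ ≤ 0 := by
      have := Int.floor_le_floor (show -D ≤ 0 by linarith); simpa using this
    have h2 := Int.lt_floor_add_one (-D)
    rw [Int.card_Icc]
    have : (((0 + 1 - ⌊-D⌋).toNat : ℤ) : ℝ) = 1 - ⌊-D⌋ := by
      rw [Int.toNat_of_nonneg (by omega)]; push_cast; ring
    rw [Int.cast_natCast] at this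
    rw [this]; linarith
  have e : √l / l = 1 / √l := by
    rw [div_eq_div_iff h0.ne' hs.ne']; rw [Real.mul_self_sqrt h0.le]; ring
  have h1 : 1 ≤ 1 / √l := by rw [le_div_iff₀ hs]; linarith
  rw [e]
  have e2 : 6 / √l = 6 * (1 / √l) := by ring
  have e3 : 2 / √l = 2 * (1 / √l) := by ring
  rw [e2, e3]
  apply mul_le_mul hc (by linarith) (by linarith) (by linarith)

lemma abel (z : ℕ → ℂ) (w : ℕ → ℝ) (P : ℝ) (M : ℕ) (hw : ∀ i, 0 ≤ w i) (ha : ∀ i, w (i+1) ≤ w i)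
    (hP : ∀ m, m ≤ M → ‖∑ i ∈ range m, z i‖ ≤ P) :
    ‖∑ i ∈ range M, w i * z i‖ ≤ w 0 * P := by
  have main : ∀ m, m ≤ M → ‖∑ i ∈ range m, w i * z i - w m * ∑ i ∈ range m, z i‖ ≤ (w 0 - w m) * P := by
    intro m
    induction m with
    | zero => simp
    | succ m ih =>
      intro hm
      have h1 := ih (by omega)
      have h2 := hP (m+1) hm
      have e : ∑ i ∈ range (m+1), (w i : ℂ) * z i - w (m+1) * ∑ i ∈ range (m+1), z i =
        (∑ i ∈ range m, (w i : ℂ) * z i - w m * ∑ i ∈ range m, z i) +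
          ((w m - w (m+1) : ℝ) : ℂ) * ∑ i ∈ range (m+1), z i := by
        rw [sum_range_succ, sum_range_succ]; push_cast; ring
      rw [e]
      refine (norm_add_le _ _).trans ?_
      rw [norm_mul, Complex.norm_real, Real.norm_eq_abs, abs_of_nonneg (by linarith [ha m])]
      have := mul_le_mul_of_nonneg_left h2 (show 0 ≤ w m - w (m+1) by linarith [ha m])
      linarith
  have h1 := main M le_rfl
  have h2 := hP M le_rfl
  have e : ∑ i ∈ range M, (w i : ℂ) * z i = (∑ i ∈ range M, w i * z i - w M * ∑ i ∈ range M, z i) +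
    w M * ∑ i ∈ range M, z i := by ring
  rw [e]
  refine (norm_add_le _ _).trans ?_
  rw [norm_mul, Complex.norm_real, Real.norm_eq_abs, abs_of_nonneg (hw M)]
  have := mul_le_mul_of_nonneg_left h2 (hw M)
  linarith

lemma mvt_aux (g g' : ℝ → ℝ) (hg : ∀ t, 0 < t → HasDerivAt g (g' t) t) (s h : ℝ) (hs : 0 < s)
    (hh : 0 < h) : ∃ ξ, s < ξ ∧ ξ < s + h ∧ g (s + h) - g s = h * g' ξ := by
  obtain ⟨ξ, hξ, he⟩ := exists_hasDerivAt_eq_slope g g' (show s < s + h by linarith)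
    (fun t ht => (hg t (by linarith [ht.1])).continuousAt.continuousWithinAt)
    (fun t ht => hg t (by linarith [ht.1]))
  refine ⟨ξ, hξ.1, hξ.2, ?_⟩
  rw [he, add_sub_cancel_left, mul_div_cancel₀ _ hh.ne']

lemma hd_pow (a : ℝ) (t : ℝ) (ht : 0 < t) : HasDerivAt (fun t : ℝ => t ^ a) (a * t ^ (a-1)) t :=
  Real.hasDerivAt_rpow_const (Or.inl ht.ne')

lemma hd_pow_shift (a r : ℝ) (hr : 0 ≤ r) (t : ℝ) (ht : 0 < t) :
    HasDerivAt (fun t : ℝ => (t + r) ^ a) (a * (t + r) ^ (a-1)) t := by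
  have := (hd_pow a (t + r) (by linarith)).comp_add_const t r
  exact this

lemma first_diff (c t y : ℝ) (ht : 0 < t) (hy : 0 < y) : ∃ η, t < η ∧
    ((t+1)^c - (t+1+y)^c) - (t^c - (t+y)^c) = -(y * (c * ((c-1) * η^(c-2)))) := by
  obtain ⟨ξ, h1, h2, h3⟩ := mvt_aux (fun t => (t+1)^c - t^c) (fun t => c * (t+1)^(c-1) - c * t^(c-1))
    (fun t ht => (hd_pow_shift c 1 (by norm_num) t ht).sub (hd_pow c t ht)) t y ht hy
  obtain ⟨η, h4, h5, h6⟩ := mvt_aux (fun t => t^(c-1)) (fun t => (c-1) * t^(c-1-1))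
    (fun t ht => hd_pow (c-1) t ht) ξ 1 (by linarith) (by norm_num)
  refine ⟨η, by linarith, ?_⟩
  rw [show c - 1 - 1 = c - 2 by ring] at h6
  rw [show t + y + 1 = t + 1 + y by ring] at h3
  linear_combination (-1) * h3 - y * c * h6

lemma second_diff (c t y : ℝ) (ht : 0 < t) (hy : 0 < y) : ∃ ζ, 0 < ζ ∧ ζ < t + y + 2 ∧
    (((t+1+1)^c - (t+1+1+y)^c) - ((t+1)^c - (t+1+y)^c)) - (((t+1)^c - (t+1+y)^c) - (t^c - (t+y)^c))
      = y * (c * ((c-1) * ((2-c) * ζ^(c-3)))) := by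
  obtain ⟨ξ, h1, h2, h3⟩ := mvt_aux (fun t => (t+2)^c - (t+1)^c - ((t+1)^c - t^c))
    (fun t => c * (t+2)^(c-1) - c * (t+1)^(c-1) - (c * (t+1)^(c-1) - c * t^(c-1)))
    (fun t ht => ((hd_pow_shift c 2 (by norm_num) t ht).sub (hd_pow_shift c 1 (by norm_num) t ht)).sub
      ((hd_pow_shift c 1 (by norm_num) t ht).sub (hd_pow c t ht))) t y ht hy
  obtain ⟨η, h4, h5, h6⟩ := mvt_aux (fun t => (t+1)^(c-1) - t^(c-1))
    (fun t => (c-1) * (t+1)^(c-1-1) - (c-1) * t^(c-1-1))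
    (fun t ht => (hd_pow_shift (c-1) 1 (by norm_num) t ht).sub (hd_pow (c-1) t ht))
      ξ 1 (by linarith) (by norm_num)
  obtain ⟨ζ, h7, h8, h9⟩ := mvt_aux (fun t => t^(c-1-1)) (fun t => (c-1-1) * t^(c-1-1-1))
    (fun t ht => hd_pow (c-1-1) t ht) η 1 (by linarith) (by norm_num)
  refine ⟨ζ, by linarith, by linarith, ?_⟩
  rw [show c - 1 - 1 - 1 = c - 3 by ring] at h9
  rw [show t + y + 1 = t + 1 + y by ring, show t + y + 2 = t + 1 + 1 + y by ring,
    show t + 2 = t + 1 + 1 by ring] at h3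
  rw [show ξ + 1 + 1 = ξ + 2 by ring] at h6
  linear_combination (-1) * h3 - y * c * h6 - y * c * (c-1) * h9

/-- exponential sum bound -/
lemma expsum (c : ℝ) (hc1 : 1 < c) (hc2 : c < 2) (κ : ℝ) (hκ : κ = (c-1)*(2-c)/9)
    (N y A : ℝ) (M : ℕ) (hN : 1 ≤ N) (hy : 1 ≤ y) (hyN : y ≤ N) (hA0 : 0 < A) (hA : N / 2 ≤ A)
    (hM : ∀ i : ℕ, i < M → A + i + y ≤ N) :
    ‖∑ i ∈ range M, eE ((A + i)^c - (A + i + y)^c)‖ ≤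
      24 / κ * N ^ (c/2) + 12 / √κ * N ^ ((3-c)/2) := by
  have hκ0 : 0 < κ := by rw [hκ]; apply div_pos (mul_pos _ _) <;> linarith
  have hκ1 : κ ≤ 1 := by rw [hκ]; nlinarith
  have hN0 : 0 < N := by linarith
  set l := κ * y * N ^ (c-3) with hl
  set D := 4 * y * N ^ (c-2) with hD
  have hNc3 : 0 < N ^ (c-3) := Real.rpow_pos_of_pos hN0 _
  have hNc2 : 0 < N ^ (c-2) := Real.rpow_pos_of_pos hN0 _
  have hNN : N ^ (c-2) = N * N ^ (c-3) := by
    rw [← Real.rpow_one_add' hN0.le (by linarith)]; congr 1; ring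
  have hl0 : 0 < l := by positivity
  have hlu : l ≤ N ^ (c-2) := by
    rw [hNN, hl]
    apply mul_le_mul_of_nonneg_right _ hNc3.le
    nlinarith
  have hll : κ * N ^ (c-3) ≤ l := by
    rw [hl]; apply mul_le_mul_of_nonneg_right _ hNc3.le
    nlinarith
  have hl1 : l ≤ 1 := hlu.trans (Real.rpow_le_one_of_one_le_of_nonpos hN (by linarith))
  have hDl : D = 4 / κ * (N * l) := by
    rw [hD, hl, hNN]; field_simp
  have key := vdc (fun i : ℕ => (A + i)^c - (A + i + y)^c)
    (fun i : ℕ => ((A + i + 1)^c - (A + i + 1 + y)^c) - ((A + i)^c - (A + i + y)^c)) l D hl0 hl1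
    (by positivity) M (by intro i; push_cast; rw [show A + ((i:ℝ) + 1) = A + i + 1 by ring]; ring)
    (by
      intro i hi
      have hi' := hM i hi
      have hi0 : (0:ℝ) ≤ i := Nat.cast_nonneg i
      obtain ⟨ζ, h1, h2, h3⟩ := second_diff c (A + i) y (by linarith) (by linarith)
      push_cast
      rw [show A + ((i:ℝ) + 1) = A + i + 1 by ring]
      have h4 : N ^ (c-3) / 9 ≤ ζ ^ (c-3) := by
        have : (3 * N) ^ (c-3) ≤ ζ ^ (c-3) :=
          Real.rpow_le_rpow_of_nonpos h1 (by linarith) (by linarith)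
        rw [Real.mul_rpow (by norm_num) hN0.le] at this
        have h9 : (1/9:ℝ) ≤ 3 ^ (c-3) := by
          have : (3:ℝ) ^ (-2:ℝ) ≤ 3 ^ (c-3) := Real.rpow_le_rpow_of_exponent_le (by norm_num) (by linarith)
          refine le_trans (le_of_eq ?_) this
          rw [Real.rpow_neg (by norm_num)]; norm_num
        nlinarith
      have h5 : l ≤ y * (c * ((c-1) * ((2-c) * ζ^(c-3)))) := by
        have e : l = y * (1 * ((c-1) * ((2-c) * (N ^ (c-3) / 9)))) := by rw [hl, hκ]; ring
        rw [e]
        have : 0 < c - 1 := by linarith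
        have : 0 < 2 - c := by linarith
        gcongr
      linarith)
    (by
      intro i hi
      have hi' := hM i hi
      have hi0 : (0:ℝ) ≤ i := Nat.cast_nonneg i
      obtain ⟨η, h1, h3⟩ := first_diff c (A + i) y (by linarith) (by linarith)
      rw [h3]
      have hη : 0 < η ^ (c-2) := Real.rpow_pos_of_pos (by linarith) _
      have c1 : 0 < c - 1 := by linarith
      have h4 : η ^ (c-2) ≤ 2 * N ^ (c-2) := by
        have : η ^ (c-2) ≤ (N / 2) ^ (c-2) :=
          Real.rpow_le_rpow_of_nonpos (by linarith) (by linarith) (by linarith)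
        rw [Real.div_rpow hN0.le (by norm_num)] at this
        refine this.trans ?_
        have h9 : (1/2:ℝ) ≤ 2 ^ (c-2) := by
          have : (2:ℝ) ^ (-1:ℝ) ≤ 2 ^ (c-2) := Real.rpow_le_rpow_of_exponent_le (by norm_num) (by linarith)
          refine le_trans (le_of_eq ?_) this
          rw [Real.rpow_neg (by norm_num)]; norm_num
        rw [div_le_iff₀ (by positivity)]
        nlinarith
      constructor
      · rw [neg_le_neg_iff]
        have : D = y * (2 * (1 * (2 * N ^ (c-2)))) := by rw [hD]; ring
        rw [this]
        gcongr
        linarith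
      · rw [neg_nonpos]; positivity)
  refine key.trans ?_
  have hs : 0 < √l := Real.sqrt_pos.2 hl0
  have hsu : √l ≤ N ^ ((c-2)/2) := by
    rw [Real.sqrt_le_left (by positivity), ← Real.rpow_natCast, ← Real.rpow_mul hN0.le]
    convert hlu using 2; push_cast; ring
  have hsl : √κ * N ^ ((c-3)/2) ≤ √l := by
    apply Real.le_sqrt_of_sq_le
    rw [mul_pow, Real.sq_sqrt hκ0.le, ← Real.rpow_natCast, ← Real.rpow_mul hN0.le]
    convert hll using 3; push_cast; ring
  have e1 : (D + 2) * (6 / √l) = 24 / κ * (N * √l) + 12 * (1 / √l) := by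
    rw [hDl]
    have : l = √l * √l := (Real.mul_self_sqrt hl0.le).symm
    generalize √l = s at *
    rw [this]
    field_simp
    ring
  rw [e1]
  have b1 : N * √l ≤ N ^ (c/2) := by
    have : N ^ (c/2) = N * N ^ ((c-2)/2) := by
      rw [← Real.rpow_one_add' hN0.le (by linarith)]; congr 1; ring
    rw [this]; gcongr
  have b2 : 1 / √l ≤ 1 / √κ * N ^ ((3-c)/2) := by
    have e : N ^ ((3-c)/2) = (N ^ ((c-3)/2))⁻¹ := by
      rw [← Real.rpow_neg hN0.le]; congr 1; ring
    have : 1 / √l ≤ 1 / (√κ * N ^ ((c-3)/2)) := by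
      apply one_div_le_one_div_of_le _ hsl
      have := Real.sqrt_pos.2 hκ0
      positivity
    refine this.trans (le_of_eq ?_)
    rw [e]; field_simp
  have : 12 / √κ * N ^ ((3-c)/2) = 12 * (1 / √κ * N ^ ((3-c)/2)) := by ring
  rw [this]
  gcongr

lemma conj_eE (t : ℝ) : starRingEnd ℂ (eE t) = eE (-t) := by
  unfold eE
  rw [← Complex.exp_conj]
  congr 1
  simp [Complex.conj_ofNat]

lemma zconv_refl_neg (g : ℤ → ℂ) (x : ℤ) :
    zconv g (zrefl g) (-x) = starRingEnd ℂ (zconv g (zrefl g) x) := by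
  unfold zconv zrefl
  rw [Complex.conj_tsum, ← (Equiv.subRight x).tsum_eq]
  apply tsum_congr
  intro n
  simp
  rw [mul_comm]

lemma zconv_fracMu (c : ℝ) (j : ℕ) (y : ℕ) :
    zconv (fracMu c j) (zrefl (fracMu c j)) (-(y:ℤ)) =
    ∑ i ∈ range (2^j + 1 - y - (2^(j-1)+1)),
      ((1 / ((((2^(j-1)+1 : ℕ) : ℝ) + i) * (((2^(j-1)+1 : ℕ) : ℝ) + i + y)) : ℝ) : ℂ) *
      eE ((((2^(j-1)+1 : ℕ) : ℝ) + i)^c - (((2^(j-1)+1 : ℕ) : ℝ) + i + y)^c) := by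
  unfold zconv zrefl
  have hp : ((2 ^ (j-1) : ℤ)) = ((2 ^ (j-1) : ℕ) : ℤ) := by push_cast; rfl
  have hq : ((2 ^ j : ℤ)) = ((2 ^ j : ℕ) : ℤ) := by push_cast; rfl
  set A : ℕ := 2^(j-1)+1 with hA
  have hApos : 0 < A := Nat.succ_pos _
  have hinj : Function.Injective (fun i : ℕ => (A : ℤ) + i) := by intro a b h; simpa using h
  rw [tsum_eq_sum (s := (range (2^j + 1 - y - A)).image (fun i : ℕ => (A : ℤ) + i))]
  · rw [sum_image (fun a _ b _ h => hinj h)]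
    apply sum_congr rfl
    intro i hi
    rw [mem_range] at hi
    have e : -(-(y:ℤ) - ((A:ℤ) + i)) = A + i + y := by ring
    rw [e]
    unfold fracMu
    rw [if_pos (by rw [hp, hq]; constructor <;> omega), if_pos (by rw [hp, hq]; constructor <;> omega)]
    have h1 : ∀ t : ℝ, Complex.exp (2 * Real.pi * Complex.I * (t : ℂ)) = eE t := fun t => rfl
    rw [h1, h1, map_div₀, conj_eE, sub_eq_add_neg, eE_add]
    push_cast
    simp only [map_add, map_natCast]
    have : (A : ℂ) + i ≠ 0 := by
      have h : ((A + i : ℕ) : ℂ) ≠ 0 := Nat.cast_ne_zero.2 (by positivity)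
      push_cast at h; exact h
    have : (A : ℂ) + i + y ≠ 0 := by
      have h : ((A + i + y : ℕ) : ℂ) ≠ 0 := Nat.cast_ne_zero.2 (by positivity)
      push_cast at h; exact h
    field_simp
  · intro n hn
    by_contra hne
    apply hn
    have h1 : fracMu c j n ≠ 0 := left_ne_zero_of_mul hne
    have h2 : fracMu c j (-(-(y:ℤ) - n)) ≠ 0 := by
      intro h; apply hne; rw [h]; simp
    unfold fracMu at h1 h2
    have h3 : 2 ^ (j - 1) < n ∧ n ≤ 2 ^ j := by by_contra h; rw [if_neg h] at h1; exact h1 rfl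
    have h4 : 2 ^ (j - 1) < (-(-(y:ℤ) - n)) ∧ (-(-(y:ℤ) - n)) ≤ 2 ^ j := by
      by_contra h; rw [if_neg h] at h2; exact h2 rfl
    rw [hp, hq] at h3 h4
    rw [mem_image]
    refine ⟨(n - A).toNat, ?_, ?_⟩
    · rw [mem_range]; omega
    · omega

/-- Autocorrelation bound for the fractional monomial phase `p(t) = t^c`, `c ∈ (1,2)`
non-integer: `|μ_j * μ̃_j(x)| ≤ C 2^{-(1+ε)j}` for all `x ≠ 0`. -/
theorem frac_autocorrelation (c : ℝ) (hc1 : 1 < c) (hc2 : c < 2) :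
    ∃ ε : ℝ, 0 < ε ∧ ∃ C : ℝ, 0 < C ∧
      ∀ j : ℕ, 1 ≤ j → ∀ x : ℤ, x ≠ 0 →
        ‖zconv (fracMu c j) (zrefl (fracMu c j)) x‖ ≤ C * (2 : ℝ) ^ (-(1 + ε) * j) := by
  obtain ⟨κ, hκ⟩ : ∃ κ : ℝ, κ = (c-1)*(2-c)/9 := ⟨_, rfl⟩
  have hκ0 : 0 < κ := by rw [hκ]; apply div_pos (mul_pos _ _) <;> linarith
  have hsκ := Real.sqrt_pos.2 hκ0
  obtain ⟨ε, hε⟩ : ∃ ε : ℝ, ε = min ((2-c)/2) ((c-1)/2) := ⟨_, rfl⟩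
  have hε1 : ε ≤ (2-c)/2 := by rw [hε]; exact min_le_left _ _
  have hε2 : ε ≤ (c-1)/2 := by rw [hε]; exact min_le_right _ _
  refine ⟨ε, by rw [hε]; apply lt_min <;> linarith, 4 * (24 / κ + 12 / √κ), by positivity, ?_⟩
  intro j hj
  suffices H : ∀ y : ℕ, 1 ≤ y → ‖zconv (fracMu c j) (zrefl (fracMu c j)) (-(y:ℤ))‖ ≤
      4 * (24 / κ + 12 / √κ) * (2 : ℝ) ^ (-(1 + ε) * j) by
    intro x hx
    rcases lt_or_gt_of_ne hx with h | h
    · have := H x.natAbs (by omega)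
      rwa [show -(x.natAbs : ℤ) = x by omega] at this
    · have := H x.natAbs (by omega)
      rwa [zconv_refl_neg, show (x.natAbs : ℤ) = x by omega, RCLike.norm_conj] at this
  intro y hy
  rw [zconv_fracMu]
  set M := 2^j + 1 - y - (2^(j-1)+1) with hMdef
  obtain ⟨A, hA⟩ : ∃ A : ℝ, A = ((2^(j-1)+1 : ℕ) : ℝ) := ⟨_, rfl⟩
  rw [← hA]
  obtain ⟨N, hN⟩ : ∃ N : ℝ, N = (2:ℝ)^j := ⟨_, rfl⟩
  have hN1 : 1 ≤ N := by rw [hN]; exact one_le_pow₀ (by norm_num)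
  have hN0 : 0 < N := by linarith
  have hNA : A = N / 2 + 1 := by
    rw [hA, hN]
    obtain ⟨k, rfl⟩ : ∃ k, j = k + 1 := ⟨j - 1, by omega⟩
    push_cast; rw [pow_succ]; simp
  have hy' : (1:ℝ) ≤ y := by exact_mod_cast hy
  have hRHS : (2:ℝ) ^ (-(1 + ε) * j) = N ^ (1 - ε) / N ^ 2 := by
    have : N = (2:ℝ)^(j:ℝ) := by rw [hN, Real.rpow_natCast]
    rw [← Real.rpow_natCast N 2, ← Real.rpow_sub hN0, this, ← Real.rpow_mul (by norm_num)]
    congr 1; push_cast; ring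
  rcases Nat.eq_zero_or_pos M with h0 | hMpos
  · rw [h0]; simp; positivity
  have hyN : (y:ℝ) ≤ N := by
    rw [hN]; have : y ≤ 2^j := by
      clear_value M; clear hN hA hN1; generalize 2^j = p at *; generalize 2^(j-1) = q at *; omega
    exact_mod_cast this
  have hM : ∀ i : ℕ, i < M → A + i + y ≤ N := by
    intro i hi
    have : (2^(j-1)+1) + i + y ≤ 2^j := by omega
    rw [hA, hN]; exact_mod_cast this
  have ab := abel (fun i : ℕ => eE ((A + i)^c - (A + i + y)^c))
    (fun i : ℕ => 1 / ((A + i) * (A + i + y))) ((24 / κ + 12 / √κ) * N ^ (1 - ε)) M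
    (by intro i; have : 0 < A := by linarith
        positivity)
    (by
      intro i
      have : 0 < A := by linarith
      push_cast
      gcongr <;> linarith)
    (by
      intro m hm
      refine (expsum c hc1 hc2 κ hκ N y A m hN1 hy' hyN (by linarith) (by linarith)
        (fun i hi => hM i (by omega))).trans ?_
      rw [add_mul]
      have e1 : N ^ (c/2) ≤ N ^ (1 - ε) := Real.rpow_le_rpow_of_exponent_le hN1 (by linarith)
      have e2 : N ^ ((3-c)/2) ≤ N ^ (1 - ε) := Real.rpow_le_rpow_of_exponent_le hN1 (by linarith)
      gcongr)
  refine ab.trans ?_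
  rw [hRHS]
  have hw : 1 / ((A + (0:ℕ)) * (A + (0:ℕ) + y)) ≤ 4 / N ^ 2 := by
    rw [Nat.cast_zero, add_zero, div_le_div_iff₀ (by apply mul_pos <;> linarith) (by positivity), hNA]
    nlinarith
  have hP : 0 ≤ (24 / κ + 12 / √κ) * N ^ (1 - ε) := by positivity
  refine (mul_le_mul_of_nonneg_right hw hP).trans (le_of_eq ?_)
  ring
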